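/- arXiv:math/9805053 — 2 statements merged into one kernel-verified Lean document; each statement's English description precedes it below -/
import Mathlib

section
/- Let k be an algebraically closed field and f₁, …, fₙ ∈ k[t]. For each i let gᵢ(s,t) ∈ k[s,t] be the unique polynomial with fᵢ(t) − fᵢ(s) = (t − s)·gᵢ(s,t). Suppose that at least one of the derivatives f₁′, …, fₙ′ is not the zero polynomial. Then k[f₁, …, fₙ] = k[t] (i.e., the k-subalgebra of k[t] generated by f₁, …, fₙ is all of k[t]) if and only if V(g₁, …, gₙ) = ∅. -/
open Polynomial MvPolynomial

/-- A subalgebra of `k[X]` containing a nonconstant polynomial has `k[X]` as a finite module. -/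
theorem Subalgebra.finite_polynomial_of_natDegree_ne_zero {k : Type*} [Field k]
    (A : Subalgebra k k[X]) {f : k[X]} (hfA : f ∈ A) (hf : f.natDegree ≠ 0) :
    Module.Finite A k[X] := by
  have hf0 : f ≠ 0 := by rintro rfl; simp at hf
  set p : k[X] := f * Polynomial.C f.leadingCoeff⁻¹ with hp
  have hpm : p.Monic := monic_mul_leadingCoeff_inv hf0
  have hpA : p ∈ A := A.mul_mem hfA (A.algebraMap_mem _)
  have hpd : p.natDegree ≠ 0 := by
    rwa [hp, natDegree_mul_leadingCoeff_inv f hf0]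
  have hX : IsIntegral A (Polynomial.X : k[X]) := by
    refine ⟨p.map (algebraMap k A) - Polynomial.C ⟨p, hpA⟩, ?_, ?_⟩
    · refine (hpm.map _).sub_of_left (degree_C_le.trans_lt ?_)
      rw [hpm.degree_map]
      exact natDegree_pos_iff_degree_pos.1 (Nat.pos_of_ne_zero hpd)
    · rw [Polynomial.eval₂_sub, Polynomial.eval₂_map, Polynomial.eval₂_C, ← IsScalarTower.algebraMap_eq]
      exact sub_eq_zero.2 Polynomial.eval₂_C_X
  have hint : Algebra.IsIntegral A k[X] := by
    refine ⟨fun q => ?_⟩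
    have h : Algebra.adjoin k {(Polynomial.X : k[X])} ≤
        (integralClosure A k[X]).restrictScalars k :=
      Algebra.adjoin_le (Set.singleton_subset_iff.2 hX)
    exact h (by rw [Polynomial.adjoin_X]; trivial)
  have : Algebra.FiniteType A k[X] := .of_restrictScalars_finiteType k A k[X]
  exact Algebra.IsIntegral.finite

open TensorProduct in
/-- A subalgebra `A` of `k[X]` over which `k[X]` is finite is everything as soon as the two
copies of `X` in `k[X] ⊗[A] k[X]` agree. -/
theorem Subalgebra.eq_top_of_one_tmul_X_eq {k : Type*} [Field k] (A : Subalgebra k k[X])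
    [Module.Finite A k[X]]
    (h : (1 : k[X]) ⊗ₜ[A] (Polynomial.X : k[X]) = Polynomial.X ⊗ₜ[A] 1) : A = ⊤ := by
  have hepi : Algebra.IsEpi A k[X] := by
    rw [Algebra.isEpi_iff_forall_one_tmul_eq]
    have hhom :
        (Algebra.TensorProduct.includeRight : k[X] →ₐ[A] k[X] ⊗[A] k[X]).restrictScalars k =
          (Algebra.TensorProduct.includeLeft : k[X] →ₐ[A] k[X] ⊗[A] k[X]).restrictScalars k :=
      Polynomial.algHom_ext h
    exact fun q => DFunLike.congr_fun hhom q
  rw [eq_top_iff]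
  intro q _
  obtain ⟨a, rfl⟩ := (Algebra.isEpi_iff_surjective_algebraMap_of_finite (R := A)).1 hepi q
  exact a.2

/-- The polynomials congruent to a constant modulo `(X - a) * (X - b)` form a proper subalgebra. -/
theorem Polynomial.adjoin_ne_top_of_dvd_sub_C {k : Type*} [Field k] {s : Set k[X]} (a b : k)
    (h : ∀ p ∈ s, ∃ c, (Polynomial.X - Polynomial.C a) * (Polynomial.X - Polynomial.C b) ∣
      p - Polynomial.C c) :
    Algebra.adjoin k s ≠ ⊤ := by
  set m : k[X] := (Polynomial.X - Polynomial.C a) * (Polynomial.X - Polynomial.C b) with hm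
  let S : Subalgebra k k[X] := (⊥ : Subalgebra k (k[X] ⧸ Ideal.span {m})).comap
    (Ideal.Quotient.mkₐ k (Ideal.span {m}))
  have hS (p : k[X]) : p ∈ S ↔ ∃ c, m ∣ p - Polynomial.C c := by
    rw [Subalgebra.mem_comap, Algebra.mem_bot]
    refine exists_congr fun c => ?_
    rw [← Ideal.mem_span_singleton, ← Ideal.Quotient.mk_eq_mk_iff_sub_mem, eq_comm]
    rfl
  intro htop
  have hle : Algebra.adjoin k s ≤ S := Algebra.adjoin_le fun p hp => (hS p).2 (h p hp)
  obtain ⟨c, hc⟩ := (hS Polynomial.X).1 (hle (htop ▸ Algebra.mem_top))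
  have hdeg := natDegree_le_of_dvd hc (X_sub_C_ne_zero c)
  rw [hm, natDegree_mul (X_sub_C_ne_zero a) (X_sub_C_ne_zero b)] at hdeg
  simp at hdeg

/-- A family of polynomials without a common zero generates the unit ideal. -/
theorem MvPolynomial.span_range_eq_top_of_forall_exists_eval_ne_zero {k σ ι : Type*} [Field k]
    [IsAlgClosed k] [Finite σ] (g : ι → MvPolynomial σ k)
    (h : ∀ x : σ → k, ∃ i, MvPolynomial.eval x (g i) ≠ 0) : Ideal.span (Set.range g) = ⊤ := by
  rw [← Ideal.radical_eq_top, ← vanishingIdeal_zeroLocus_eq_radical (K := k), zeroLocus_span]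
  convert vanishingIdeal_empty (k := k) (K := k) (σ := σ)
  refine Set.eq_empty_of_forall_notMem fun x hx => ?_
  obtain ⟨i, hi⟩ := h x
  exact hi (by simpa [MvPolynomial.aeval_eq_eval] using hx (g i) ⟨i, rfl⟩)

/-- If the divided differences `gᵢ` of the `fᵢ` generate the unit ideal, then two elements of a
commutative `k`-algebra at which every `fᵢ` takes the same value are equal. -/
theorem MvPolynomial.eq_of_aeval_eq_of_span_eq_top {k T ι : Type*} [Field k] [CommRing T]
    [Algebra k T] (f : ι → k[X]) (g : ι → MvPolynomial (Fin 2) k)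
    (hg : ∀ i, Polynomial.aeval (MvPolynomial.X 1 : MvPolynomial (Fin 2) k) (f i) -
          Polynomial.aeval (MvPolynomial.X 0 : MvPolynomial (Fin 2) k) (f i) =
          (MvPolynomial.X 1 - MvPolynomial.X 0) * g i)
    (hspan : Ideal.span (Set.range g) = ⊤) {x y : T}
    (h : ∀ i, Polynomial.aeval y (f i) = Polynomial.aeval x (f i)) : y = x := by
  have hzero (p : MvPolynomial (Fin 2) k) (hp : p ∈ Ideal.span (Set.range g)) :
      (y - x) * MvPolynomial.aeval ![x, y] p = 0 := by
    induction hp using Submodule.span_induction with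
    | mem p hp =>
      obtain ⟨i, rfl⟩ := hp
      have := congrArg (MvPolynomial.aeval ![x, y]) (hg i)
      simp only [map_sub, map_mul, ← Polynomial.aeval_algHom_apply, MvPolynomial.aeval_X,
        Matrix.cons_val_zero, Matrix.cons_val_one] at this
      rw [← this, h i, sub_self]
    | zero => simp
    | add p q _ _ hp hq => rw [map_add, mul_add, hp, hq, add_zero]
    | smul r p _ hp => rw [smul_eq_mul, map_mul, mul_left_comm, hp, mul_zero]
  simpa [sub_eq_zero] using hzero 1 (hspan ▸ Submodule.mem_top)

open TensorProduct in
/-- For an algebraically closed field `k`, with some `fᵢ'` nonzero,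
`k[f₁,…,fₙ] = k[t]` iff `V(g₁,…,gₙ) = ∅`. -/
theorem adjoin_eq_top_iff_zero_set_empty {k : Type*} [Field k] [IsAlgClosed k] {n : ℕ}
    (f : Fin n → Polynomial k) (g : Fin n → MvPolynomial (Fin 2) k)
    (hg : ∀ i, Polynomial.aeval (MvPolynomial.X 1 : MvPolynomial (Fin 2) k) (f i) -
          Polynomial.aeval (MvPolynomial.X 0 : MvPolynomial (Fin 2) k) (f i) =
          (MvPolynomial.X 1 - MvPolynomial.X 0) * g i)
    (hf : ∃ i, Polynomial.derivative (f i) ≠ 0) :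
    Algebra.adjoin k (Set.range f) = ⊤ ↔
      {p : k × k | ∀ i, MvPolynomial.eval ![p.1, p.2] (g i) = 0} = ∅ := by
  constructor
  · intro htop
    refine Set.eq_empty_of_forall_notMem ?_
    rintro ⟨a, b⟩ hab
    refine Polynomial.adjoin_ne_top_of_dvd_sub_C a b ?_ htop
    rintro _ ⟨i, rfl⟩
    refine ⟨(f i).eval a, ?_⟩
    have h := congrArg (MvPolynomial.aeval ![Polynomial.C a, Polynomial.X]) (hg i)
    simp only [map_sub, map_mul, ← Polynomial.aeval_algHom_apply, MvPolynomial.aeval_X,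
      Matrix.cons_val_zero, Matrix.cons_val_one, Polynomial.aeval_X_left_apply] at h
    have hC : Polynomial.aeval (Polynomial.C a) (f i) = Polynomial.C ((f i).eval a) :=
      Polynomial.aeval_algebraMap_apply_eq_algebraMap_eval a (f i)
    rw [← hC, h]
    refine mul_dvd_mul_left _ (dvd_iff_isRoot.2 ?_)
    have hcomp : ((Polynomial.aeval b).comp
        (MvPolynomial.aeval ![Polynomial.C a, Polynomial.X]) : MvPolynomial (Fin 2) k →ₐ[k] k) =
        MvPolynomial.aeval ![a, b] := by
      ext j; fin_cases j <;> simp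
    have := DFunLike.congr_fun hcomp (g i)
    rw [AlgHom.comp_apply, Polynomial.coe_aeval_eq_eval, MvPolynomial.aeval_eq_eval] at this
    exact this.trans (hab i)
  · intro hempty
    obtain ⟨i₀, hi₀⟩ := hf
    set A := Algebra.adjoin k (Set.range f)
    have hfA (i) : f i ∈ A := Algebra.subset_adjoin ⟨i, rfl⟩
    have : Module.Finite A k[X] := A.finite_polynomial_of_natDegree_ne_zero (hfA i₀)
      fun h => hi₀ (derivative_of_natDegree_zero h)
    refine A.eq_top_of_one_tmul_X_eq ?_
    have hspan : Ideal.span (Set.range g) = ⊤ := by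
      refine MvPolynomial.span_range_eq_top_of_forall_exists_eval_ne_zero g fun x => ?_
      by_contra! hx
      refine hempty.le (show (x 0, x 1) ∈ _ from fun i => ?_)
      rw [← hx i]
      congr 2
      ext j; fin_cases j <;> rfl
    refine MvPolynomial.eq_of_aeval_eq_of_span_eq_top f g hg hspan fun i => ?_
    have hr := Polynomial.aeval_algHom_apply ((Algebra.TensorProduct.includeRight :
      k[X] →ₐ[A] k[X] ⊗[A] k[X]).restrictScalars k) Polynomial.X (f i)
    have hl := Polynomial.aeval_algHom_apply ((Algebra.TensorProduct.includeLeft :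
      k[X] →ₐ[A] k[X] ⊗[A] k[X]).restrictScalars k) Polynomial.X (f i)
    rw [Polynomial.aeval_X_left_apply] at hr hl
    exact hr.trans ((Algebra.TensorProduct.tmul_one_eq_one_tmul (⟨f i, hfA i⟩ : A)).symm.trans
      hl.symm)
end

section
/- Let k be an algebraically closed field and f₁, …, fₙ ∈ k[t], and suppose that at least one of the derivatives f₁′, …, fₙ′ is not the zero polynomial. Let ψ: k → kⁿ be the map a ↦ (f₁(a), …, fₙ(a)). If k(f₁, …, fₙ) = k(t) (i.e., the subfield of the rational function field k(t) generated over k by f₁, …, fₙ is all of k(t)), then the set A_ψ = {(a,b) ∈ k² : a ≠ b and ψ(a) = ψ(b)} is finite. -/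
open Polynomial

/-- The value at `a` of a polynomial expression in the `f i` depends only on the values `f i (a)`. -/
theorem eval_mvPolynomial_aeval {k ι : Type*} [CommSemiring k] (f : ι → Polynomial k)
    (r : MvPolynomial ι k) (a : k) :
    eval a (MvPolynomial.aeval f r) = MvPolynomial.aeval (fun i => eval a (f i)) r := by
  have := MvPolynomial.comp_aeval_apply (R := k) (f := f) (Polynomial.aeval a) r
  simpa [Polynomial.coe_aeval_eq_eval] using this

/-- For an algebraically closed field `k`, with some `fᵢ'` nonzero, if
`k(f₁,…,fₙ) = k(t)` then `A_ψ = {(a,b) : a ≠ b, ψ(a) = ψ(b)}` is finite. -/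
theorem Apsi_finite_of_field_adjoin_eq_top {k : Type*} [Field k] [IsAlgClosed k] {n : ℕ}
    (f : Fin n → Polynomial k)
    (hf : ∃ i, Polynomial.derivative (f i) ≠ 0)
    (ψ : k → Fin n → k) (hψ : ∀ a i, ψ a i = Polynomial.eval a (f i))
    (h : IntermediateField.adjoin k
      (Set.range fun i => algebraMap (Polynomial k) (RatFunc k) (f i)) = ⊤) :
    {p : k × k | p.1 ≠ p.2 ∧ ψ p.1 = ψ p.2}.Finite := by
  have hX : (RatFunc.X : RatFunc k) ∈ IntermediateField.adjoin k
      (Set.range fun i => algebraMap (Polynomial k) (RatFunc k) (f i)) := h ▸ trivial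
  obtain ⟨r, s, hrs⟩ := (IntermediateField.mem_adjoin_range_iff k _ _).1 hX
  have hmap (u : MvPolynomial (Fin n) k) :
      MvPolynomial.aeval (fun i => algebraMap (Polynomial k) (RatFunc k) (f i)) u =
        algebraMap (Polynomial k) (RatFunc k) (MvPolynomial.aeval f u) :=
    MvPolynomial.aeval_algebraMap_apply (RatFunc k) f u
  rw [hmap, hmap] at hrs
  set q := MvPolynomial.aeval f s
  have hq0 : q ≠ 0 := fun h0 => RatFunc.X_ne_zero (by simpa [h0] using hrs)
  have hXq : X * q = MvPolynomial.aeval f r := by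
    apply RatFunc.algebraMap_injective k
    rw [map_mul, RatFunc.algebraMap_X, hrs,
      div_mul_cancel₀ _ (RatFunc.algebraMap_ne_zero hq0)]
  have hroots : {a | q.IsRoot a}.Finite := Polynomial.finite_setOfPred_isRoot hq0
  refine (hroots.prod hroots).subset ?_
  rintro ⟨a, b⟩ ⟨hab, heq⟩
  have hfab : (fun i => eval a (f i)) = fun i => eval b (f i) := by
    funext i
    rw [← hψ, ← hψ, heq]
  have hval (u : MvPolynomial (Fin n) k) :
      eval a (MvPolynomial.aeval f u) = eval b (MvPolynomial.aeval f u) := by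
    rw [eval_mvPolynomial_aeval, eval_mvPolynomial_aeval, hfab]
  have hqab : eval a q = eval b q := hval s
  have hmul : a * eval a q = b * eval b q := by
    simpa [← hXq] using hval r
  have hqa : eval a q = 0 := by
    rw [← hqab] at hmul
    exact (mul_eq_mul_right_iff.1 hmul).resolve_left hab
  exact ⟨hqa, hqab.symm.trans hqa⟩
end
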